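/- arXiv:2408.00212 — 2 statements merged into one kernel-verified Lean document; each statement's English description precedes it below -/
import Mathlib

section
/- Let N ≥ 3 be an odd integer and κ ∈ (0,1), and let G be the N×N matrix with entries G_{jk} = ψ_k(1, θ_j). Then G is invertible; consequently, for every vector f ∈ ℝ^N the collocation linear system G·Q = f has a unique solution Q ∈ ℝ^N (the DSM-QR approximate solution exists uniquely). -/
open Matrix

/-- The DSM-QR basis function `ψ_k(s,θ)` (1-based index `k`): `ψ_1(s,θ) = √N` and, for
`m = 1,…,(N−1)/2`, `ψ_{2m}(s,θ) = √(N/2)(s^m sin(mθ) − κ^{N−2m} s^{N−m} sin((N−m)θ))`,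
`ψ_{2m+1}(s,θ) = √(N/2)(s^m cos(mθ) + κ^{N−2m} s^{N−m} cos((N−m)θ))`. -/
noncomputable def psi (N : ℕ) (κ : ℝ) (k : ℕ) (s θ : ℝ) : ℝ :=
  if k = 1 then Real.sqrt N
  else if k % 2 = 0 then
    Real.sqrt ((N : ℝ) / 2) *
      (s ^ (k / 2) * Real.sin ((k / 2 : ℕ) * θ) -
        κ ^ (N - 2 * (k / 2)) * s ^ (N - k / 2) * Real.sin (((N - k / 2 : ℕ) : ℝ) * θ))
  else
    Real.sqrt ((N : ℝ) / 2) *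
      (s ^ (k / 2) * Real.cos ((k / 2 : ℕ) * θ) +
        κ ^ (N - 2 * (k / 2)) * s ^ (N - k / 2) * Real.cos (((N - k / 2 : ℕ) : ℝ) * θ))

/-- The collocation angle `θ_j = 2πj/N`. -/
noncomputable def theta (N : ℕ) (j : ℕ) : ℝ := 2 * Real.pi * j / N

/-- The DSM-QR collocation matrix `G`, with `G_{jk} = ψ_k(1, θ_j)` (1-based `j,k`). -/
noncomputable def Gmat (N : ℕ) (κ : ℝ) : Matrix (Fin N) (Fin N) ℝ := fun j k =>
  psi N κ (k.val + 1) 1 (theta N (j.val + 1))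

/-- Discrete orthogonality of the characters `θ ↦ exp (i a θ)` on the collocation angles. -/
lemma sum_exp_theta (N : ℕ) (hN : 0 < N) (a : ℤ) :
    ∑ j : Fin N, Complex.exp (((a * theta N (j.val + 1) : ℝ) : ℂ) * Complex.I) =
      if (N : ℤ) ∣ a then (N : ℂ) else 0 := by
  have hN0 : (N : ℂ) ≠ 0 := by exact_mod_cast hN.ne'
  set ζ : ℂ := Complex.exp (a * (2 * Real.pi * Complex.I) / N) with hζ
  have hpow (j : Fin N) :
      Complex.exp (((a * theta N (j.val + 1) : ℝ) : ℂ) * Complex.I) = ζ ^ j.val * ζ := by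
    rw [← pow_succ, hζ, ← Complex.exp_nat_mul]
    congr 1
    simp only [theta]
    push_cast
    ring
  have hζN : ζ ^ N = 1 := by
    rw [hζ, ← Complex.exp_nat_mul, mul_div_cancel₀ _ hN0, Complex.exp_int_mul_two_pi_mul_I]
  have hζ1 : ζ = 1 ↔ (N : ℤ) ∣ a := by
    have hpi : (2 * Real.pi * Complex.I : ℂ) ≠ 0 := Complex.two_pi_I_ne_zero
    rw [hζ, Complex.exp_eq_one_iff]
    refine exists_congr fun n => ?_
    rw [div_eq_iff hN0, show (n * (2 * Real.pi * Complex.I) * N : ℂ)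
      = (N * n) * (2 * Real.pi * Complex.I) by ring, mul_left_inj' hpi]
    norm_cast
  simp_rw [hpow, ← Finset.sum_mul]
  rw [Fin.sum_univ_eq_sum_range (fun j => ζ ^ j) N]
  split_ifs with h
  · simp [hζ1.2 h]
  · rw [geom_sum_eq (fun h1 => h (hζ1.1 h1)), hζN]
    simp

lemma sum_cos_theta (N : ℕ) (hN : 0 < N) (a : ℤ) :
    ∑ j : Fin N, Real.cos (a * theta N (j.val + 1)) = if (N : ℤ) ∣ a then (N : ℝ) else 0 := by
  have h := congrArg Complex.re (sum_exp_theta N hN a)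
  rw [Complex.re_sum] at h
  simp only [Complex.exp_ofReal_mul_I_re] at h
  rw [h]
  split_ifs <;> simp

lemma sum_sin_theta (N : ℕ) (hN : 0 < N) (a : ℤ) :
    ∑ j : Fin N, Real.sin (a * theta N (j.val + 1)) = 0 := by
  have h := congrArg Complex.im (sum_exp_theta N hN a)
  rw [Complex.im_sum] at h
  simp only [Complex.exp_ofReal_mul_I_im] at h
  rw [h]
  split_ifs <;> simp

lemma sub_mul_theta (N m : ℕ) (hN : 0 < N) (hm : m ≤ N) (j : ℕ) :
    ((N - m : ℕ) : ℝ) * theta N j = j * (2 * Real.pi) - m * theta N j := by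
  have hN0 : (N : ℝ) ≠ 0 := by exact_mod_cast hN.ne'
  rw [Nat.cast_sub hm]
  simp only [theta]
  field_simp

/-- The real Fourier basis `1, sin θ, cos θ, sin 2θ, cos 2θ, …`, indexed from `0`. -/
noncomputable def trigBasis (i : ℕ) (θ : ℝ) : ℝ :=
  if i % 2 = 0 then Real.cos (((i + 1) / 2 : ℕ) * θ) else Real.sin (((i + 1) / 2 : ℕ) * θ)

/-- On the collocation angles each DSM-QR basis function is a positive multiple of a Fourier mode. -/
lemma Gmat_eq_mul_trigBasis (N : ℕ) (κ : ℝ) (hκ : 0 < κ) (i : Fin N) :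
    ∃ c : ℝ, 0 < c ∧ ∀ j : Fin N, Gmat N κ j i = c * trigBasis i (theta N (j.val + 1)) := by
  have hi := i.isLt
  have hN : 0 < N := by omega
  have hNr : (0 : ℝ) < N := by exact_mod_cast hN
  have hm : (i.val + 1) / 2 ≤ N := by omega
  by_cases h0 : i.val = 0
  · exact ⟨Real.sqrt N, Real.sqrt_pos.2 hNr, fun j => by simp [Gmat, psi, trigBasis, h0]⟩
  refine ⟨Real.sqrt ((N : ℝ) / 2) * (1 + κ ^ (N - 2 * ((i.val + 1) / 2))), by positivity,
    fun j => ?_⟩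
  have h1 : ¬ i.val + 1 = 1 := by omega
  simp only [Gmat, psi, trigBasis, if_neg h1, one_pow, sub_mul_theta N _ hN hm]
  by_cases h2 : i.val % 2 = 0
  · rw [if_neg (by omega), if_pos h2, Real.cos_nat_mul_two_pi_sub]
    ring
  · rw [if_pos (by omega), if_neg h2, Real.sin_nat_mul_two_pi_sub]
    ring

lemma sum_trigBasis_mul_eq_zero (N : ℕ) (hNodd : Odd N) (i l : Fin N) (hil : i ≠ l) :
    ∑ j : Fin N, trigBasis i (theta N (j.val + 1)) * trigBasis l (theta N (j.val + 1)) = 0 := by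
  have hi := i.isLt
  have hl := l.isLt
  have hil' : i.val ≠ l.val := fun h => hil (Fin.ext h)
  have hN : 0 < N := by omega
  obtain ⟨r, hr⟩ := hNodd
  set m := (i.val + 1) / 2 with hm
  set n := (l.val + 1) / 2 with hn
  have hcast (θ : ℝ) : (((m : ℤ) - n : ℤ) : ℝ) * θ = m * θ - n * θ ∧
      (((m : ℤ) + n : ℤ) : ℝ) * θ = m * θ + n * θ := by
    constructor <;> push_cast <;> ring
  have hsub := sum_cos_theta N hN ((m : ℤ) - n)
  have hadd := sum_cos_theta N hN ((m : ℤ) + n)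
  have ssub := sum_sin_theta N hN ((m : ℤ) - n)
  have sadd := sum_sin_theta N hN ((m : ℤ) + n)
  simp only [(hcast _).1, (hcast _).2, Real.cos_sub, Real.cos_add, Real.sin_sub, Real.sin_add,
    Finset.sum_add_distrib, Finset.sum_sub_distrib] at hsub hadd ssub sadd
  have dvd_small (a : ℤ) (h1 : -N < a) (h2 : a < N) (h3 : a ≠ 0) : ¬ (N : ℤ) ∣ a := fun h =>
    h3 (Int.eq_zero_of_abs_lt_dvd h (abs_lt.2 ⟨h1, h2⟩))
  simp only [trigBasis, ← hm, ← hn]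
  split_ifs with h1 h2 h2
  · rw [if_neg (dvd_small _ (by omega) (by omega) (by omega))] at hsub hadd
    linarith
  · linarith
  · linarith
  · rw [if_neg (dvd_small _ (by omega) (by omega) (by omega))] at hsub hadd
    linarith

lemma sum_trigBasis_sq_pos (N : ℕ) (hNodd : Odd N) (i : Fin N) :
    0 < ∑ j : Fin N, trigBasis i (theta N (j.val + 1)) * trigBasis i (theta N (j.val + 1)) := by
  have hi := i.isLt
  have hN : 0 < N := by omega
  have hNr : (0 : ℝ) < N := by exact_mod_cast hN
  obtain ⟨r, hr⟩ := hNodd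
  set m := (i.val + 1) / 2 with hm
  have hsub := sum_cos_theta N hN ((m : ℤ) - m)
  have hadd := sum_cos_theta N hN ((m : ℤ) + m)
  have hcast (θ : ℝ) : (((m : ℤ) - m : ℤ) : ℝ) * θ = m * θ - m * θ ∧
      (((m : ℤ) + m : ℤ) : ℝ) * θ = m * θ + m * θ := by
    constructor <;> push_cast <;> ring
  simp only [(hcast _).1, (hcast _).2, Real.cos_sub, Real.cos_add,
    Finset.sum_add_distrib, Finset.sum_sub_distrib] at hsub hadd
  rw [if_pos (by simp)] at hsub
  simp only [trigBasis, ← hm]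
  split_ifs with h1
  · split_ifs at hadd <;> linarith
  · rw [if_neg fun h => by
      have := Int.eq_zero_of_abs_lt_dvd h (abs_lt.2 ⟨by omega, by omega⟩)
      omega] at hadd
    linarith

lemma Gmat_transpose_mul_self (N : ℕ) (hNodd : Odd N) (κ : ℝ) (hκ : 0 < κ) :
    ∃ d : Fin N → ℝ, (∀ i, 0 < d i) ∧ (Gmat N κ)ᵀ * Gmat N κ = Matrix.diagonal d := by
  choose c hc hG using Gmat_eq_mul_trigBasis N κ hκ
  refine ⟨fun i => c i * c i * ∑ j : Fin N,
    trigBasis i (theta N (j.val + 1)) * trigBasis i (theta N (j.val + 1)),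
    fun i => mul_pos (mul_pos (hc i) (hc i)) (sum_trigBasis_sq_pos N hNodd i), ?_⟩
  ext i l
  have key : ((Gmat N κ)ᵀ * Gmat N κ) i l = c i * c l * ∑ j : Fin N,
      trigBasis i (theta N (j.val + 1)) * trigBasis l (theta N (j.val + 1)) := by
    simp only [Matrix.mul_apply, Matrix.transpose_apply, hG, Finset.mul_sum]
    exact Finset.sum_congr rfl fun j _ => by ring
  rw [key]
  by_cases hil : i = l
  · subst hil
    rw [Matrix.diagonal_apply_eq]
  · rw [Matrix.diagonal_apply_ne _ hil, sum_trigBasis_mul_eq_zero N hNodd i l hil, mul_zero]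

theorem Gmat_invertible (N : ℕ) (hNodd : Odd N) (hN3 : 3 ≤ N)
    (κ : ℝ) (hκ : κ ∈ Set.Ioo (0 : ℝ) 1) :
    IsUnit (Gmat N κ) ∧
    ∀ f : Fin N → ℝ, ∃! Q : Fin N → ℝ, Gmat N κ *ᵥ Q = f := by
  obtain ⟨d, hd, hGd⟩ := Gmat_transpose_mul_self N hNodd κ hκ.1
  have hdet : (Gmat N κ).det ≠ 0 := fun h => by
    have h2 := congrArg Matrix.det hGd
    rw [Matrix.det_mul, h, mul_zero, Matrix.det_diagonal] at h2
    exact (Finset.prod_pos fun i _ => hd i).ne h2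
  have hU : IsUnit (Gmat N κ) := (Matrix.isUnit_iff_isUnit_det _).2 hdet.isUnit
  have hbij : Function.Bijective (Gmat N κ).mulVec :=
    ⟨Matrix.mulVec_injective_iff_isUnit.2 hU, Matrix.mulVec_surjective_iff_isUnit.2 hU⟩
  exact ⟨hU, hbij.existsUnique⟩
end

section
/- Let N ≥ 3 be an odd integer and κ ∈ (0,1), and let G be the N×N matrix with entries G_{jk} = ψ_k(1, θ_j). Then G is invertible and its ℓ²-condition number satisfies cond₂(G) = ‖G‖₂·‖G⁻¹‖₂ = 2/(1 + κ^{N−2}), where ‖·‖₂ denotes the operator norm induced by the Euclidean norm on ℝ^N. In particular cond₂(G) ≤ 2 for all such N, so the DSM-QR coefficient matrix is well-conditioned uniformly in N. -/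
open Matrix

/-- The operator norm of an `N×N` real matrix induced by the Euclidean (`ℓ²`) norm on `ℝ^N`. -/
noncomputable def l2OpNorm (N : ℕ) (M : Matrix (Fin N) (Fin N) ℝ) : ℝ :=
  ‖(Matrix.toEuclideanLin M).toContinuousLinearMap‖

open scoped Matrix.Norms.L2Operator in
theorem l2OpNorm_eq_norm (N : ℕ) (M : Matrix (Fin N) (Fin N) ℝ) : l2OpNorm N M = ‖M‖ := rfl

theorem isUnit_of_transpose_mul_self_eq_diagonal {N : ℕ} {M : Matrix (Fin N) (Fin N) ℝ}
    {d : Fin N → ℝ} (hd : ∀ i, 0 < d i) (h : Mᵀ * M = diagonal fun i => d i ^ 2) : IsUnit M := by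
  rw [Matrix.isUnit_iff_isUnit_det, isUnit_iff_ne_zero]
  intro h0
  have h1 := congrArg Matrix.det h
  rw [det_mul, h0, mul_zero, det_diagonal] at h1
  exact (Finset.prod_pos fun i _ => pow_pos (hd i) 2).ne h1

open scoped Matrix.Norms.L2Operator in
theorem l2OpNorm_of_transpose_mul_self_eq_diagonal {N : ℕ} {M : Matrix (Fin N) (Fin N) ℝ}
    {d : Fin N → ℝ} (hd : ∀ i, 0 < d i) (h : Mᵀ * M = diagonal fun i => d i ^ 2)
    (i₀ : Fin N) (hi₀ : ∀ i, d i ≤ d i₀) : l2OpNorm N M = d i₀ := by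
  have h1 : ‖M‖ * ‖M‖ = ‖fun i => d i ^ 2‖ := by
    rw [← l2_opNorm_diagonal, ← h, ← l2_opNorm_conjTranspose_mul_self,
      conjTranspose_eq_transpose_of_trivial]
  have h2 : ‖fun i => d i ^ 2‖ = d i₀ ^ 2 := by
    refine le_antisymm ((pi_norm_le_iff_of_nonneg (by positivity)).2 fun i => ?_) ?_
    · rw [Real.norm_of_nonneg (by positivity)]
      exact pow_le_pow_left₀ (hd i).le (hi₀ i) 2
    · exact (Real.le_norm_self _).trans (norm_le_pi_norm (fun i => d i ^ 2) i₀)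
  rw [l2OpNorm_eq_norm]
  rw [h2, ← sq] at h1
  exact (pow_left_inj₀ (norm_nonneg M) (hd i₀).le two_ne_zero).1 h1

theorem l2OpNorm_transpose (N : ℕ) (M : Matrix (Fin N) (Fin N) ℝ) :
    l2OpNorm N Mᵀ = l2OpNorm N M := by
  rw [l2OpNorm_eq_norm, l2OpNorm_eq_norm, ← conjTranspose_eq_transpose_of_trivial,
    l2_opNorm_conjTranspose]

theorem l2OpNorm_inv_of_transpose_mul_self_eq_diagonal {N : ℕ} {M : Matrix (Fin N) (Fin N) ℝ}
    {d : Fin N → ℝ} (hd : ∀ i, 0 < d i) (h : Mᵀ * M = diagonal fun i => d i ^ 2)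
    (i₀ : Fin N) (hi₀ : ∀ i, d i₀ ≤ d i) : l2OpNorm N M⁻¹ = (d i₀)⁻¹ := by
  rw [← l2OpNorm_transpose]
  refine l2OpNorm_of_transpose_mul_self_eq_diagonal (d := fun i => (d i)⁻¹)
    (fun i => inv_pos.2 (hd i)) ?_ i₀ fun i => inv_anti₀ (hd i₀) (hi₀ i)
  rw [transpose_transpose, transpose_nonsing_inv, ← Matrix.mul_inv_rev, h]
  refine inv_eq_left_inv ?_
  rw [diagonal_mul_diagonal, ← diagonal_one]
  congr 1
  ext i
  have := (hd i).ne'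
  field_simp

theorem sum_cos_mul_theta_sub {N : ℕ} (hN : N ≠ 0) {n : ℤ} (hn : ¬ (N : ℤ) ∣ n) (φ : ℝ) :
    ∑ j : Fin N, Real.cos (n * theta N (j.val + 1) - φ) = 0 := by
  have hN' : (N : ℝ) ≠ 0 := Nat.cast_ne_zero.2 hN
  have hs : Real.sin (n * Real.pi / N) ≠ 0 := by
    rw [Ne, Real.sin_eq_zero_iff]
    rintro ⟨k, hk⟩
    apply hn
    refine ⟨k, ?_⟩
    field_simp at hk
    have : (n : ℝ) = N * k := by linarith
    exact_mod_cast this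
  let f : ℕ → ℝ := fun j => Real.sin ((2 * j + 1) * (n * Real.pi / N) - φ)
  have hstep (j : ℕ) : 2 * Real.sin (n * Real.pi / N) * Real.cos (n * theta N (j + 1) - φ) =
      f (j + 1) - f j := by
    simp only [f, theta]
    rw [Real.sin_sub_sin]
    push_cast
    congr 2 <;> [congr 1; skip] <;> ring
  have hsum := Finset.sum_range_sub f N
  have hper : f N = f 0 := by
    simp only [f]
    rw [← Real.sin_add_int_mul_two_pi ((2 * ((0 : ℕ) : ℝ) + 1) * (n * Real.pi / N) - φ) n]
    congr 1
    field_simp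
    push_cast
    ring
  simp_rw [← hstep, ← Finset.mul_sum, hper, sub_self] at hsum
  rw [Fin.sum_univ_eq_sum_range (fun j => Real.cos (n * theta N (j + 1) - φ))]
  exact (mul_eq_zero.1 hsum).resolve_left (mul_ne_zero two_ne_zero hs)

/-- The phase of the `k`-th trigonometric column, `0`-based: sines are shifted cosines. -/
noncomputable def phase (k : ℕ) : ℝ := if k % 2 = 1 then Real.pi / 2 else 0

/-- The amplitude of the `k`-th column of `Gmat N κ`, `0`-based. -/
noncomputable def amplitude (N : ℕ) (κ : ℝ) (k : ℕ) : ℝ :=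
  if k = 0 then Real.sqrt N else Real.sqrt ((N : ℝ) / 2) * (1 + κ ^ (N - 2 * ((k + 1) / 2)))

/-- The singular value of `Gmat N κ` belonging to the `k`-th column, `0`-based. -/
noncomputable def singularValue (N : ℕ) (κ : ℝ) (k : ℕ) : ℝ :=
  if k = 0 then N else (N : ℝ) / 2 * (1 + κ ^ (N - 2 * ((k + 1) / 2)))

theorem Gmat_apply {N : ℕ} (κ : ℝ) (j k : Fin N) :
    Gmat N κ j k = amplitude N κ k *
      Real.cos ((((k.val + 1) / 2 : ℕ) : ℤ) * theta N (j.val + 1) - phase k) := by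
  have hN' : (N : ℝ) ≠ 0 := Nat.cast_ne_zero.2 (by have := k.isLt; omega)
  have hk : (k.val + 1) / 2 ≤ N := by omega
  simp only [Gmat, psi, amplitude, phase]
  have hang : ((N - (k.val + 1) / 2 : ℕ) : ℝ) * theta N (j.val + 1) =
      (j.val + 1 : ℕ) * (2 * Real.pi) - (((k.val + 1) / 2 : ℕ) : ℝ) * theta N (j.val + 1) := by
    rw [Nat.cast_sub hk, sub_mul]
    congr 1
    simp only [theta]
    field_simp
  rw [hang, Real.sin_nat_mul_two_pi_sub, Real.cos_nat_mul_two_pi_sub]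
  by_cases h0 : k.val = 0
  · simp [h0]
  · by_cases h1 : k.val % 2 = 1
    · have h2 : (k.val + 1) % 2 = 0 := by omega
      simp only [h0, h1, h2, Real.cos_sub_pi_div_two, Nat.add_eq_right, if_true, if_false, one_pow,
        Int.cast_natCast]
      ring
    · have h2 : ¬ (k.val + 1) % 2 = 0 := by omega
      simp only [h0, h1, h2, Nat.add_eq_right, if_false, one_pow, sub_zero, Int.cast_natCast]
      ring

theorem Gmat_transpose_mul_self_s9 {N : ℕ} (hNodd : Odd N) (κ : ℝ) :
    (Gmat N κ)ᵀ * Gmat N κ = diagonal fun k : Fin N => singularValue N κ k ^ 2 := by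
  ext k l
  have hN : N ≠ 0 := by rintro rfl; exact k.elim0
  obtain ⟨r, hr⟩ := hNodd
  have hk := k.isLt
  have hl := l.isLt
  set a : ℤ := (((k.val + 1) / 2 : ℕ) : ℤ) with ha
  set b : ℤ := (((l.val + 1) / 2 : ℕ) : ℤ) with hb
  have hprod (j : Fin N) : Gmat N κ j k * Gmat N κ j l =
      amplitude N κ k * amplitude N κ l / 2 *
        (Real.cos (((a + b : ℤ) : ℝ) * theta N (j.val + 1) - (phase k + phase l)) +
          Real.cos (((a - b : ℤ) : ℝ) * theta N (j.val + 1) - (phase k - phase l))) := by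
    rw [Gmat_apply, Gmat_apply, ← ha, ← hb, Real.cos_add_cos, Int.cast_add, Int.cast_sub]
    rw [show ∀ x y z w : ℝ, x * y * (z * w) = x * z / 2 * (2 * y * w) by intros; ring]
    congr 3 <;> ring_nf
  rw [mul_apply]
  simp only [transpose_apply, hprod, ← Finset.mul_sum, Finset.sum_add_distrib]
  have hdvd {n : ℤ} (h1 : n ≠ 0) (h2 : |n| < N) : ¬ (N : ℤ) ∣ n := fun h =>
    h1 (Int.eq_zero_of_abs_lt_dvd h h2)
  by_cases hkl : k = l
  · subst hkl
    have hab : a = b := rfl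
    by_cases h0 : k.val = 0
    · have ha0 : a = 0 := by simp [ha, h0]
      rw [diagonal_apply_eq]
      simp only [← hab, ha0, h0, phase, amplitude, singularValue]
      simp
      ring
    · rw [sum_cos_mul_theta_sub hN (n := a + b) (hdvd (by omega) (by rw [abs_lt]; omega)),
        diagonal_apply_eq]
      simp only [hab, h0, amplitude, singularValue]
      have := Real.mul_self_sqrt (show (0 : ℝ) ≤ N / 2 by positivity)
      generalize Real.sqrt ((N : ℝ) / 2) = c at this ⊢
      simp
      linear_combination (1 + κ ^ (N - 2 * ((k.val + 1) / 2))) ^ 2 / 2 * N * this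
  · have hkl' : k.val ≠ l.val := fun h => hkl (Fin.ext h)
    rw [diagonal_apply_ne _ hkl,
      sum_cos_mul_theta_sub hN (n := a + b) (hdvd (by omega) (by rw [abs_lt]; omega))]
    by_cases hab : a = b
    · have hc : Real.cos (phase k - phase l) = 0 := by
        simp only [phase]
        split_ifs <;> first | omega | simp
      simp only [hab, sub_self, Int.cast_zero, zero_mul, zero_sub, Real.cos_neg, hc]
      simp
    · rw [sum_cos_mul_theta_sub hN (n := a - b) (hdvd (by omega) (by rw [abs_lt]; omega))]
      simp

theorem singularValue_pos {N : ℕ} (hN : N ≠ 0) {κ : ℝ} (hκ : 0 ≤ κ) (k : ℕ) :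
    0 < singularValue N κ k := by
  unfold singularValue
  split_ifs <;> positivity

theorem singularValue_le {N : ℕ} {κ : ℝ} (hκ₀ : 0 ≤ κ) (hκ₁ : κ ≤ 1) (k : ℕ) :
    singularValue N κ k ≤ singularValue N κ 0 := by
  simp only [singularValue, if_true]
  split_ifs
  · rfl
  · nlinarith [pow_le_one₀ (n := N - 2 * ((k + 1) / 2)) hκ₀ hκ₁, (Nat.cast_nonneg N : (0 : ℝ) ≤ N)]

theorem singularValue_one_le {N : ℕ} {κ : ℝ} (hκ₀ : 0 ≤ κ) (hκ₁ : κ ≤ 1) (k : ℕ) :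
    singularValue N κ 1 ≤ singularValue N κ k := by
  by_cases h : k = 0
  · subst h
    exact singularValue_le hκ₀ hκ₁ 1
  · simp only [singularValue, h, one_ne_zero, if_false]
    gcongr ?_ * (1 + ?_)
    exact pow_le_pow_of_le_one hκ₀ hκ₁ (by omega)

theorem Gmat_condition_number (N : ℕ) (hNodd : Odd N) (hN3 : 3 ≤ N)
    (κ : ℝ) (hκ : κ ∈ Set.Ioo (0 : ℝ) 1) :
    IsUnit (Gmat N κ) ∧
    l2OpNorm N (Gmat N κ) * l2OpNorm N (Gmat N κ)⁻¹ = 2 / (1 + κ ^ (N - 2)) ∧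
    l2OpNorm N (Gmat N κ) * l2OpNorm N (Gmat N κ)⁻¹ ≤ 2 := by
  obtain ⟨hκ₀, hκ₁⟩ := hκ
  have hN : N ≠ 0 := by omega
  have hpos (k : Fin N) := singularValue_pos hN hκ₀.le k
  have hG := Gmat_transpose_mul_self_s9 hNodd κ
  have hcond : l2OpNorm N (Gmat N κ) * l2OpNorm N (Gmat N κ)⁻¹ = 2 / (1 + κ ^ (N - 2)) := by
    rw [l2OpNorm_of_transpose_mul_self_eq_diagonal hpos hG ⟨0, by omega⟩
        fun k => singularValue_le hκ₀.le hκ₁.le k,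
      l2OpNorm_inv_of_transpose_mul_self_eq_diagonal hpos hG ⟨1, by omega⟩
        fun k => singularValue_one_le hκ₀.le hκ₁.le k]
    have hN' : (N : ℝ) ≠ 0 := Nat.cast_ne_zero.2 hN
    simp only [singularValue, one_ne_zero, if_true, if_false]
    norm_num
    field_simp
  refine ⟨isUnit_of_transpose_mul_self_eq_diagonal hpos hG, hcond, ?_⟩
  rw [hcond]
  exact div_le_self zero_le_two (le_add_of_nonneg_right (by positivity))
end
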